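/- Suppose P, Q : Type → Type are invariant under equivalence, that for every type Z either P Z is inhabited or Q Z is inhabited, and that there are types X, Y with P X empty and Q Y empty. Then weak excluded middle holds. -/

import Mathlib

/-- Glue `X`, present when `p` holds, to `Y`, present when `p` fails. -/
abbrev Glue (p : Prop) (X Y : Type) : Type :=
  {_x : X // p} ⊕ {_y : Y // ¬ p}

theorem nonempty_glue_equiv_left {p : Prop} (hp : p) (X Y : Type) :
    Nonempty (Glue p X Y ≃ X) :=
  haveI : IsEmpty {_y : Y // ¬ p} := ⟨fun y => y.2 hp⟩
  ⟨(Equiv.sumEmpty _ _).trans (Equiv.subtypeUnivEquiv fun _ => hp)⟩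

theorem nonempty_glue_equiv_right {p : Prop} (hp : ¬ p) (X Y : Type) :
    Nonempty (Glue p X Y ≃ Y) :=
  haveI : IsEmpty {_x : X // p} := ⟨fun x => hp x.2⟩
  ⟨(Equiv.emptySum _ _).trans (Equiv.subtypeUnivEquiv fun _ => hp)⟩

/-- If `P Q : Type → Type` are invariant under equivalence, every type lies in
`P` or in `Q` (inhabitedness), and there are types `X`, `Y` with `P X` empty
and `Q Y` empty, then weak excluded middle holds. -/
theorem stmt_8 (P Q : Type → Type)
    (hP : ∀ X Y : Type, Nonempty (X ≃ Y) → Nonempty (P X ≃ P Y))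
    (hQ : ∀ X Y : Type, Nonempty (X ≃ Y) → Nonempty (Q X ≃ Q Y))
    (hcover : ∀ Z : Type, Nonempty (P Z) ∨ Nonempty (Q Z))
    (X Y : Type) (hX : IsEmpty (P X)) (hY : IsEmpty (Q Y)) :
    ∀ A : Type, IsEmpty A ∨ ¬ IsEmpty A := by
  intro A
  -- The argument is constructive: it does not appeal to excluded middle.
  rcases hcover (Glue (IsEmpty A) X Y) with ⟨⟨z⟩⟩ | ⟨⟨z⟩⟩
  · refine Or.inr fun hA => ?_
    obtain ⟨e⟩ := hP _ _ (nonempty_glue_equiv_left hA X Y)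
    exact hX.false (e z)
  · refine Or.inl ⟨fun a => ?_⟩
    obtain ⟨e⟩ := hQ _ _ (nonempty_glue_equiv_right (p := IsEmpty A) (fun hA => hA.false a) X Y)
    exact hY.false (e z)
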